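/- arXiv:2605.00204 — 4 statements merged into one kernel-verified Lean document; each statement's English description precedes it below -/
import Mathlib

section
/- Let n ≥ 2, k ∈ ℕ₀, and let f : ℝ^n → ℝ be smooth and compactly supported. For every a ∈ ℝ^n and every unit vector v ∈ 𝕊^{n-1}, the (k+1)-fold directional derivative of a ↦ R^k f(a,v) along v satisfies (D_v)^{k+1} R^k f(a,v) = (−1)^{k+1} k! f(a). -/
open MeasureTheory Set

/-- The `k`-weighted divergent beam transform `R^k f(a,v) = ∫_0^∞ f(a + r v) r^k dr`. -/
noncomputable def divergentBeam (n k : ℕ) (f : EuclideanSpace ℝ (Fin n) → ℝ)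
    (a v : EuclideanSpace ℝ (Fin n)) : ℝ :=
  ∫ r in Ioi (0 : ℝ), f (a + r • v) * r ^ k

/-- The directional-derivative operator `D_v` acting on functions `ℝ^n → ℝ`. -/
noncomputable def dirDeriv (n : ℕ) (v : EuclideanSpace ℝ (Fin n))
    (g : EuclideanSpace ℝ (Fin n) → ℝ) : EuclideanSpace ℝ (Fin n) → ℝ :=
  fun a => fderiv ℝ g a v

lemma HasCompactSupport.comp_line {E F : Type*} [NormedAddCommGroup E] [NormedSpace ℝ E]
    [Zero F] {f : E → F} (hf : HasCompactSupport f) (a : E) {v : E} (hv : v ≠ 0) :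
    HasCompactSupport fun r : ℝ => f (a + r • v) := by
  have h : Topology.IsClosedEmbedding fun r : ℝ => a + r • v :=
    (Homeomorph.addLeft a).isClosedEmbedding.comp (isClosedEmbedding_smul_left hv)
  exact hf.comp_isClosedEmbedding h

lemma HasCompactSupport.integrable_line_smul_pow {E F : Type*} [NormedAddCommGroup E]
    [NormedSpace ℝ E] [NormedAddCommGroup F] [NormedSpace ℝ F] {f : E → F}
    (hf : HasCompactSupport f) (hc : Continuous f) (a : E) {v : E} (hv : v ≠ 0) (k : ℕ) :
    Integrable fun r : ℝ => r ^ k • f (a + r • v) :=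
  Continuous.integrable_of_hasCompactSupport (by fun_prop) (hf.comp_line a hv).smul_left

lemma hasFDerivAt_integral_line_smul_pow {E : Type*} [NormedAddCommGroup E]
    [NormedSpace ℝ E] {f : E → ℝ} (hf : ContDiff ℝ 1 f)
    (hfc : HasCompactSupport f) (a : E) {v : E} (hv : ‖v‖ = 1) (k : ℕ) :
    HasFDerivAt (fun b => ∫ r in Ioi (0 : ℝ), r ^ k • f (b + r • v))
      (∫ r in Ioi (0 : ℝ), r ^ k • fderiv ℝ f (a + r • v)) a := by
  have hv0 : v ≠ 0 := by
    rintro rfl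
    simp at hv
  have hf' : Continuous (fderiv ℝ f) := hf.continuous_fderiv one_ne_zero
  have hfc' : HasCompactSupport (fderiv ℝ f) := hfc.fderiv ℝ
  obtain ⟨C, hC⟩ := hfc'.exists_bound_of_continuous hf'
  obtain ⟨M, hM⟩ := hfc'.isCompact.isBounded.subset_closedBall a
  set B : ℝ → ℝ := (Icc (-(M + 1)) (M + 1)).indicator fun r => |r| ^ k * C
  refine hasFDerivAt_integral_of_dominated_of_fderiv_le (bound := B)
    (F' := fun b r => r ^ k • fderiv ℝ f (b + r • v)) (Metric.ball_mem_nhds a one_pos) ?_ ?_ ?_ ?_ ?_ ?_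
  · refine Filter.Eventually.of_forall fun b => ?_
    exact (hfc.integrable_line_smul_pow hf.continuous b hv0 k).aestronglyMeasurable.restrict
  · exact (hfc.integrable_line_smul_pow hf.continuous a hv0 k).restrict
  · exact (hfc'.integrable_line_smul_pow hf' a hv0 k).aestronglyMeasurable.restrict
  · refine Filter.Eventually.of_forall fun r b hb => ?_
    by_cases hr : r ∈ Icc (-(M + 1)) (M + 1)
    · simp only [B, indicator_of_mem hr, norm_smul, norm_pow, Real.norm_eq_abs]
      gcongr
      exact hC _
    · have h0 : fderiv ℝ f (b + r • v) = 0 := by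
        refine image_eq_zero_of_notMem_tsupport fun hmem => hr ?_
        have h1 := hM hmem
        rw [Metric.mem_closedBall, dist_eq_norm] at h1
        rw [Metric.mem_ball, dist_eq_norm] at hb
        have h2 : ‖r • v‖ ≤ ‖b + r • v - a‖ + ‖b - a‖ := by
          have h3 : r • v = (b + r • v - a) - (b - a) := by abel
          calc ‖r • v‖ = ‖(b + r • v - a) - (b - a)‖ := by rw [← h3]
            _ ≤ _ := norm_sub_le _ _
        rw [norm_smul, hv, mul_one, Real.norm_eq_abs] at h2
        exact abs_le.mp (by linarith)
      simp only [B, h0, indicator_of_notMem hr, smul_zero, norm_zero, le_refl]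
  · refine Integrable.restrict ?_
    rw [integrable_indicator_iff measurableSet_Icc]
    exact (by fun_prop : Continuous fun r : ℝ => |r| ^ k * C).continuousOn.integrableOn_compact
      isCompact_Icc
  · refine Filter.Eventually.of_forall fun r b _ => ?_
    have h := ((hf.differentiable one_ne_zero) (b + r • v)).hasFDerivAt
    exact ((hasFDerivAt_comp_add_right (r • v)).2 h).const_smul (r ^ k)

lemma dirDeriv_divergentBeam {n : ℕ} (k : ℕ) {f : EuclideanSpace ℝ (Fin n) → ℝ}
    (hf : ContDiff ℝ 1 f) (hfc : HasCompactSupport f)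
    (a : EuclideanSpace ℝ (Fin n)) {v : EuclideanSpace ℝ (Fin n)} (hv : ‖v‖ = 1) :
    dirDeriv n v (fun b => divergentBeam n k f b v) a
      = ∫ r in Ioi (0 : ℝ), r ^ k * fderiv ℝ f (a + r • v) v := by
  have hv0 : v ≠ 0 := by
    rintro rfl
    simp at hv
  have h := hasFDerivAt_integral_line_smul_pow hf hfc a hv k
  have hI : Integrable (fun r : ℝ => r ^ k • fderiv ℝ f (a + r • v))
      (volume.restrict (Ioi 0)) :=
    ((hfc.fderiv ℝ).integrable_line_smul_pow (hf.continuous_fderiv one_ne_zero) a hv0 k).restrict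
  simp only [dirDeriv, divergentBeam, mul_comm (f _)]
  simp only [smul_eq_mul] at h
  rw [h.fderiv, ContinuousLinearMap.integral_apply hI]
  rfl

lemma hasDerivAt_comp_line {E : Type*} [NormedAddCommGroup E] [NormedSpace ℝ E] {f : E → ℝ}
    (hf : Differentiable ℝ f) (a v : E) (r : ℝ) :
    HasDerivAt (fun r : ℝ => f (a + r • v)) (fderiv ℝ f (a + r • v) v) r := by
  have h : HasDerivAt (fun r : ℝ => a + r • v) v r := by
    simpa using ((hasDerivAt_id r).smul_const v).const_add a
  exact (hf (a + r • v)).hasFDerivAt.comp_hasDerivAt r h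

lemma dirDeriv_divergentBeam_zero {n : ℕ} {f : EuclideanSpace ℝ (Fin n) → ℝ}
    (hf : ContDiff ℝ 1 f) (hfc : HasCompactSupport f)
    (a : EuclideanSpace ℝ (Fin n)) {v : EuclideanSpace ℝ (Fin n)} (hv : ‖v‖ = 1) :
    dirDeriv n v (fun b => divergentBeam n 0 f b v) a = -f a := by
  have hv0 : v ≠ 0 := by
    rintro rfl
    simp at hv
  rw [dirDeriv_divergentBeam 0 hf hfc a hv]
  have h := (hfc.comp_line a hv0).integral_Ioi_deriv_eq (by fun_prop) 0
  simp only [(hasDerivAt_comp_line (hf.differentiable one_ne_zero) a v _).deriv] at h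
  simpa using h

lemma dirDeriv_divergentBeam_succ {n : ℕ} (k : ℕ) {f : EuclideanSpace ℝ (Fin n) → ℝ}
    (hf : ContDiff ℝ 1 f) (hfc : HasCompactSupport f)
    (a : EuclideanSpace ℝ (Fin n)) {v : EuclideanSpace ℝ (Fin n)} (hv : ‖v‖ = 1) :
    dirDeriv n v (fun b => divergentBeam n (k + 1) f b v) a
      = -(k + 1 : ℝ) * divergentBeam n k f a v := by
  have hv0 : v ≠ 0 := by
    rintro rfl
    simp at hv
  rw [dirDeriv_divergentBeam (k + 1) hf hfc a hv]
  have hd (r : ℝ) : HasDerivAt (fun r : ℝ => r ^ (k + 1) * f (a + r • v))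
      ((k + 1) * (r ^ k * f (a + r • v)) + r ^ (k + 1) * fderiv ℝ f (a + r • v) v) r := by
    refine ((hasDerivAt_pow (k + 1) r).fun_mul
      (hasDerivAt_comp_line (hf.differentiable one_ne_zero) a v r)).congr_deriv ?_
    push_cast
    rw [mul_assoc]
  have hcs : HasCompactSupport fun r : ℝ => r ^ (k + 1) * f (a + r • v) :=
    (hfc.comp_line a hv0).mul_left
  have h := hcs.integral_Ioi_deriv_eq (by fun_prop) 0
  have hI : Integrable (fun r : ℝ => r ^ k * f (a + r • v)) (volume.restrict (Ioi 0)) :=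
    (hfc.integrable_line_smul_pow hf.continuous a hv0 k).restrict
  have hI' : Integrable (fun r : ℝ => r ^ (k + 1) * fderiv ℝ f (a + r • v) v)
      (volume.restrict (Ioi 0)) :=
    ((hfc.fderiv_apply ℝ v).integrable_line_smul_pow
      ((hf.continuous_fderiv one_ne_zero).clm_apply continuous_const) a hv0 (k + 1)).restrict
  simp only [(hd _).deriv] at h
  rw [integral_add (hI.const_mul _) hI', integral_const_mul] at h
  simp only [divergentBeam, mul_comm (f _)]
  simp only [ne_eq, Nat.add_eq_zero_iff, one_ne_zero, and_false, not_false_eq_true, zero_pow,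
    zero_mul, neg_zero] at h
  linarith

lemma dirDeriv_const_mul {n : ℕ} (v : EuclideanSpace ℝ (Fin n)) (c : ℝ)
    (g : EuclideanSpace ℝ (Fin n) → ℝ) :
    dirDeriv n v (fun a => c * g a) = fun a => c * dirDeriv n v g a := by
  ext a
  have h := congrArg (· v) (congrFun (fderiv_const_smul_field (𝕜 := ℝ) (f := g) c) a)
  exact h

lemma dirDeriv_iterate_const_mul {n : ℕ} (v : EuclideanSpace ℝ (Fin n)) (c : ℝ) (m : ℕ)
    (g : EuclideanSpace ℝ (Fin n) → ℝ) :
    (dirDeriv n v)^[m] (fun a => c * g a) = fun a => c * (dirDeriv n v)^[m] g a := by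
  induction m generalizing g with
  | zero => rfl
  | succ m ih => rw [Function.iterate_succ_apply, dirDeriv_const_mul, ih]; rfl

/-- For `f ∈ C_c^∞(ℝ^n)`, `n ≥ 2`, `k ∈ ℕ₀`, the `(k+1)`-fold directional
derivative of `a ↦ R^k f(a,v)` along `v` satisfies
`(D_v)^{k+1} R^k f(a,v) = (-1)^{k+1} k! f(a)`. -/
theorem statement2 (n k : ℕ) (hn : 2 ≤ n)
    (f : EuclideanSpace ℝ (Fin n) → ℝ)
    (hf : ContDiff ℝ (⊤ : ℕ∞) f) (hfc : HasCompactSupport f)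
    (a v : EuclideanSpace ℝ (Fin n)) (hv : ‖v‖ = 1) :
    (dirDeriv n v)^[k + 1] (fun b => divergentBeam n k f b v) a
      = (-1) ^ (k + 1) * (Nat.factorial k : ℝ) * f a := by
  have hf1 : ContDiff ℝ 1 f := hf.of_le (by exact_mod_cast le_top)
  induction k with
  | zero => simpa using dirDeriv_divergentBeam_zero hf1 hfc a hv
  | succ k ih =>
    have hs : dirDeriv n v (fun b => divergentBeam n (k + 1) f b v)
        = fun b => -(k + 1 : ℝ) * divergentBeam n k f b v :=
      funext fun b => dirDeriv_divergentBeam_succ k hf1 hfc b hv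
    rw [Function.iterate_succ_apply, hs, dirDeriv_iterate_const_mul]
    beta_reduce
    rw [ih, Nat.factorial_succ]
    push_cast
    ring
end

section
/- Let n ≥ 2, k ∈ ℕ₀, let A ⊂ ℝ^n be a bounded open convex set, and fix v ∈ 𝕊^{n-1}. Let w : ℝ^n → ℝ be of class C^{k+1}. Assume: (1) (D_v)^{k+1} w(a) = 0 for every a ∈ A; and (2) for every boundary point b ∈ ∂A such that b + t v ∉ A for all t > 0, one has (D_v)^j w(b) = 0 for j = 0, 1, …, k. Then w(a) = 0 for every a in the closure of A. -/
open MeasureTheory Set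

/-- Each directional derivative costs one degree of smoothness. -/
theorem ContDiff.iterate_dirDeriv {n : ℕ} (v : EuclideanSpace ℝ (Fin n)) (j m : ℕ)
    {w : EuclideanSpace ℝ (Fin n) → ℝ} (hw : ContDiff ℝ (m + j : ℕ) w) :
    ContDiff ℝ (m : ℕ) ((dirDeriv n v)^[j] w) := by
  induction j generalizing m with
  | zero => simpa using hw
  | succ j ih =>
    rw [Function.iterate_succ_apply']
    have h : ContDiff ℝ (m + 1 : ℕ) ((dirDeriv n v)^[j] w) :=
      ih (m + 1) (by rwa [add_assoc, add_comm 1 j])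
    exact (h.fderiv_right (by norm_cast)).clm_apply contDiff_const

/-- Along a line in direction `v`, the derivative is the directional derivative. -/
theorem hasDerivAt_dirDeriv_line {n : ℕ} {a v : EuclideanSpace ℝ (Fin n)} {t : ℝ}
    {g : EuclideanSpace ℝ (Fin n) → ℝ} (hg : DifferentiableAt ℝ g (a + t • v)) :
    HasDerivAt (fun s : ℝ => g (a + s • v)) (dirDeriv n v g (a + t • v)) t := by
  have hl : HasDerivAt (fun s : ℝ => a + s • v) v t := by
    simpa using ((hasDerivAt_id t).smul_const v).const_add a
  exact hg.hasFDerivAt.comp_hasDerivAt t hl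

/-- A ray from a point of a bounded open convex set leaves it through a boundary point, and does
not re-enter. -/
theorem Convex.exists_exit_time {E : Type*} [NormedAddCommGroup E] [NormedSpace ℝ E]
    {A : Set E} (hAo : IsOpen A) (hAb : Bornology.IsBounded A) (hAc : Convex ℝ A)
    {a v : E} (ha : a ∈ A) (hv : ‖v‖ = 1) :
    ∃ T : ℝ, 0 < T ∧ (∀ s ∈ Ico 0 T, a + s • v ∈ A) ∧ a + T • v ∈ frontier A ∧
      ∀ t : ℝ, 0 < t → (a + T • v) + t • v ∉ A := by
  have hcont : Continuous fun s : ℝ => a + s • v := by fun_prop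
  let S : Set ℝ := Ici 0 ∩ (fun s : ℝ => a + s • v) ⁻¹' Aᶜ
  have hS : IsClosed S := isClosed_Ici.inter (hAo.isClosed_compl.preimage hcont)
  have hbdd : BddBelow S := ⟨0, fun s hs => hs.1⟩
  have hne : S.Nonempty := by
    obtain ⟨R, hR⟩ := hAb.subset_closedBall a
    refine ⟨|R| + 1, by simp only [mem_Ici]; positivity, fun h => ?_⟩
    have h' := hR h
    rw [mem_closedBall_iff_norm, add_sub_cancel_left, norm_smul, hv, mul_one, Real.norm_eq_abs,
      abs_of_pos (by positivity)] at h'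
    linarith [le_abs_self R]
  have hT : sInf S ∈ S := hS.csInf_mem hne hbdd
  set T := sInf S
  have hTpos : 0 < T := by
    refine lt_of_le_of_ne hT.1 fun h => hT.2 ?_
    simpa [← h] using ha
  have hin : ∀ s ∈ Ico 0 T, a + s • v ∈ A := fun s hs => by
    by_contra hsA
    exact (csInf_le hbdd ⟨hs.1, hsA⟩).not_gt hs.2
  refine ⟨T, hTpos, hin, ?_, fun t ht htA => hT.2 ?_⟩
  · rw [hAo.frontier_eq]
    refine ⟨?_, hT.2⟩
    have hcl : T ∈ closure (Ico 0 T) := by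
      rw [closure_Ico hTpos.ne]
      exact right_mem_Icc.2 hTpos.le
    exact map_mem_closure (f := fun s : ℝ => a + s • v) hcont hcl hin
  · have hpos : 0 < T + t := by positivity
    have hmem := hAc.add_smul_sub_mem ha htA (t := T / (T + t))
      ⟨by positivity, (div_le_one hpos).2 (by linarith)⟩
    rwa [add_assoc, ← add_smul, add_sub_cancel_left, smul_smul, div_mul_cancel₀ _ hpos.ne'] at hmem

/-- Let `A ⊂ ℝ^n` be a bounded open convex set and `v` a unit vector. If
`w ∈ C^{k+1}` satisfies `(D_v)^{k+1} w = 0` on `A` and `(D_v)^j w = 0`, `j = 0,…,k`, at every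
boundary point whose forward ray in direction `v` never re-enters `A`, then `w = 0` on the
closure of `A`. -/
theorem statement4 (n k : ℕ) (hn : 2 ≤ n)
    (A : Set (EuclideanSpace ℝ (Fin n)))
    (hAo : IsOpen A) (hAb : Bornology.IsBounded A) (hAc : Convex ℝ A)
    (v : EuclideanSpace ℝ (Fin n)) (hv : ‖v‖ = 1)
    (w : EuclideanSpace ℝ (Fin n) → ℝ) (hw : ContDiff ℝ (k + 1 : ℕ) w)
    (h1 : ∀ a ∈ A, (dirDeriv n v)^[k + 1] w a = 0)
    (h2 : ∀ b ∈ frontier A, (∀ t : ℝ, 0 < t → b + t • v ∉ A) →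
      ∀ j ≤ k, (dirDeriv n v)^[j] w b = 0) :
    ∀ a ∈ closure A, w a = 0 := by
  refine closure_minimal (t := w ⁻¹' {0}) (fun a ha => ?_)
    (isClosed_singleton.preimage hw.continuous)
  obtain ⟨T, hT, hin, hfr, hout⟩ := hAc.exists_exit_time hAo hAb ha hv
  have key : ∀ i j : ℕ, j + i = k + 1 →
      ∀ s ∈ Ico 0 T, (dirDeriv n v)^[j] w (a + s • v) = 0 := by
    intro i
    induction i with
    | zero =>
      rintro j rfl s hs
      exact h1 _ (hin s hs)
    | succ i ih =>
      intro j hj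
      have hC : ContDiff ℝ (i + 1 : ℕ) ((dirDeriv n v)^[j] w) :=
        ContDiff.iterate_dirDeriv v j (i + 1) (by rwa [add_comm (i + 1) j, hj])
      have hd : Differentiable ℝ ((dirDeriv n v)^[j] w) := hC.differentiable (by simp)
      have hconst := constant_of_has_deriv_right_zero
        (f := fun s : ℝ => (dirDeriv n v)^[j] w (a + s • v)) (a := 0) (b := T)
        (hC.continuous.comp (by fun_prop)).continuousOn (fun s hs => by
          have h := hasDerivAt_dirDeriv_line (hd (a + s • v))
          rw [← Function.iterate_succ_apply' (dirDeriv n v),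
            ih (j + 1) (by omega) s hs] at h
          exact h.hasDerivWithinAt)
      intro s hs
      exact (hconst s (Ico_subset_Icc_self hs)).trans
        ((hconst T (right_mem_Icc.2 hT.le)).symm.trans (h2 _ hfr hout j (by omega)))
  simpa using key (k + 1) 0 (by simp) 0 ⟨le_rfl, hT⟩
end

section
/- Let n ≥ 2, k ∈ ℕ₀, let A ⊂ ℝ^n be a bounded open convex set, and let f : ℝ^n → ℝ be smooth with compact support contained in A. Fix v ∈ 𝕊^{n-1} and let u : ℝ^n → ℝ be of class C^{k+1}. Then u(a) = R^k f(a,v) for every a in the closure of A if and only if both of the following hold: (1) (D_v)^{k+1} u(a) = (−1)^{k+1} k! f(a) for every a ∈ A; and (2) for every boundary point b ∈ ∂A with b + t v ∉ A for all t > 0, one has (D_v)^j u(b) = 0 for j = 0, 1, …, k. -/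
open MeasureTheory Set

section BeamPrimitive

open scoped Convolution

theorem hasDerivAt_integral_Ioi_comp_add_mul_pow {φ : ℝ → ℝ} (hφ : ContDiff ℝ 1 φ)
    (hc : HasCompactSupport φ) (i : ℕ) (t : ℝ) :
    HasDerivAt (fun t => ∫ r in Ioi (0 : ℝ), φ (t + r) * r ^ i)
      (∫ r in Ioi (0 : ℝ), deriv φ (t + r) * r ^ i) t := by
  set w : ℝ → ℝ := (Ioi (0 : ℝ)).indicator fun r => r ^ i with hw
  have hwloc : LocallyIntegrable w volume :=
    ((continuous_pow i).locallyIntegrable).indicator measurableSet_Ioi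
  have hconv : ∀ (ψ : ℝ → ℝ) (s : ℝ),
      (w ⋆[ContinuousLinearMap.mul ℝ ℝ, volume] (fun x => ψ (-x))) (-s)
        = ∫ r in Ioi (0 : ℝ), ψ (s + r) * r ^ i := by
    intro ψ s
    rw [convolution_def, ← integral_indicator measurableSet_Ioi]
    refine integral_congr_ae (Filter.Eventually.of_forall fun r => ?_)
    by_cases hr : r ∈ Ioi (0 : ℝ)
    · simp only [hw, ContinuousLinearMap.mul_apply', indicator_of_mem hr]
      rw [show -(-s - r) = s + r by ring, mul_comm]
    · simp only [hw, ContinuousLinearMap.mul_apply', indicator_of_notMem hr, zero_mul]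
  have hd : deriv (fun x => φ (-x)) = fun x => -deriv φ (-x) := by
    funext x
    exact deriv_comp_neg φ x
  have key := (HasCompactSupport.hasDerivAt_convolution_right (ContinuousLinearMap.mul ℝ ℝ)
    hwloc (hc.comp_homeomorph (Homeomorph.neg ℝ)) (hφ.comp contDiff_neg) (-t)).comp t
      (hasDerivAt_neg t)
  change HasDerivAt (fun s => (w ⋆[ContinuousLinearMap.mul ℝ ℝ, volume] (fun x => φ (-x))) (-s))
    ((w ⋆[ContinuousLinearMap.mul ℝ ℝ, volume] (deriv fun x => φ (-x))) (-t) * -1) t at key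
  rw [hd, hconv (fun y => -deriv φ y)] at key
  simp only [hconv φ, neg_mul, integral_neg, mul_neg, mul_one, neg_neg] at key
  exact key

theorem integral_Ioi_deriv_comp_add {φ : ℝ → ℝ} (hφ : ContDiff ℝ 1 φ)
    (hc : HasCompactSupport φ) (t : ℝ) :
    ∫ r in Ioi (0 : ℝ), deriv φ (t + r) = -φ t := by
  have h := HasCompactSupport.integral_Ioi_deriv_eq
    (hφ.comp (contDiff_const.add contDiff_id : ContDiff ℝ 1 fun r : ℝ => t + r))
    (hc.comp_homeomorph (Homeomorph.addLeft t)) 0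
  have hd : deriv (φ ∘ fun r : ℝ => t + r) = fun r => deriv φ (t + r) := by
    funext r
    exact deriv_comp_const_add φ t r
  rw [hd] at h
  simpa using h

theorem integral_Ioi_deriv_comp_add_mul_pow_succ {φ : ℝ → ℝ} (hφ : ContDiff ℝ 1 φ)
    (hc : HasCompactSupport φ) (i : ℕ) (t : ℝ) :
    ∫ r in Ioi (0 : ℝ), deriv φ (t + r) * r ^ (i + 1)
      = -((i + 1 : ℝ) * ∫ r in Ioi (0 : ℝ), φ (t + r) * r ^ i) := by
  have hcs : ∀ {ψ : ℝ → ℝ}, HasCompactSupport ψ → HasCompactSupport fun r => ψ (t + r) :=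
    fun h => h.comp_homeomorph (Homeomorph.addLeft t)
  have hprod : ∀ {ψ : ℝ → ℝ} (j : ℕ), Continuous ψ → HasCompactSupport ψ →
      IntegrableOn (fun r => ψ (t + r) * r ^ j) (Ioi (0 : ℝ)) := fun j h1 h2 =>
    (Continuous.integrable_of_hasCompactSupport (by fun_prop) (hcs h2).mul_right).integrableOn
  have h := HasCompactSupport.integral_Ioi_deriv_eq (f := fun r => φ (t + r) * r ^ (i + 1))
    (by fun_prop) (hcs hc).mul_right 0
  have hd : deriv (fun r => φ (t + r) * r ^ (i + 1))
      = fun r => deriv φ (t + r) * r ^ (i + 1) + (i + 1 : ℝ) * (φ (t + r) * r ^ i) := by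
    funext r
    have h1 : HasDerivAt (fun r => φ (t + r)) (deriv φ (t + r)) r :=
      ((hφ.differentiable one_ne_zero (t + r)).hasDerivAt).comp_const_add t r
    refine (h1.mul (hasDerivAt_pow (i + 1) r)).deriv.trans ?_
    push_cast
    ring
  rw [hd, integral_add (hprod _ (hφ.continuous_deriv le_rfl) hc.deriv)
    ((hprod i hφ.continuous hc).const_mul _), integral_const_mul] at h
  simp only [pow_succ, mul_zero, neg_zero] at h ⊢
  linarith

variable {E : Type*} [NormedAddCommGroup E] [NormedSpace ℝ E]

/-- The `i`-fold primitive of `f` along `-v`, given by Cauchy's formula for repeated integration. -/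
noncomputable def beamPrimitive (f : E → ℝ) (v : E) : ℕ → E → ℝ
  | 0, a => f a
  | i + 1, a => (∫ r in Ioi (0 : ℝ), f (a + r • v) * r ^ i) / (Nat.factorial i : ℝ)

theorem hasCompactSupport_comp_line {f : E → ℝ} (hc : HasCompactSupport f) {v : E}
    (hv : ‖v‖ = 1) (a : E) : HasCompactSupport fun r : ℝ => f (a + r • v) := by
  have hiso : Isometry fun r : ℝ => a + r • v := by
    refine Isometry.of_dist_eq fun x y => ?_
    rw [dist_add_left, dist_eq_norm, ← sub_smul, norm_smul, hv, mul_one, dist_eq_norm]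
  exact hc.comp_isClosedEmbedding hiso.isClosedEmbedding

theorem hasDerivAt_beamPrimitive {f : E → ℝ} (hf : ContDiff ℝ 1 f) (hc : HasCompactSupport f)
    {v : E} (hv : ‖v‖ = 1) (i : ℕ) (a : E) (t : ℝ) :
    HasDerivAt (fun t : ℝ => beamPrimitive f v (i + 1) (a + t • v))
      (-beamPrimitive f v i (a + t • v)) t := by
  set φ : ℝ → ℝ := fun r => f (a + r • v) with hφdef
  have hφ : ContDiff ℝ 1 φ := by fun_prop
  have hφc : HasCompactSupport φ := hasCompactSupport_comp_line hc hv a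
  have hline : ∀ s r : ℝ, f (a + s • v + r • v) = φ (s + r) := fun s r => by
    simp only [hφdef, add_smul, add_assoc]
  have h := (hasDerivAt_integral_Ioi_comp_add_mul_pow hφ hφc i t).div_const (Nat.factorial i : ℝ)
  cases i with
  | zero =>
    simp only [pow_zero, mul_one, integral_Ioi_deriv_comp_add hφ hφc] at h
    simpa only [beamPrimitive, hline, pow_zero, mul_one, Nat.factorial_zero, Nat.cast_one,
      div_one] using h
  | succ i =>
    rw [integral_Ioi_deriv_comp_add_mul_pow_succ hφ hφc] at h
    simp only [beamPrimitive, hline]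
    refine h.congr_deriv ?_
    have : (Nat.factorial i : ℝ) ≠ 0 := Nat.cast_ne_zero.2 i.factorial_ne_zero
    rw [Nat.factorial_succ]
    push_cast
    field_simp

theorem beamPrimitive_eq_zero {f : E → ℝ} {v a : E} (h : ∀ r : ℝ, 0 ≤ r → f (a + r • v) = 0)
    (i : ℕ) : beamPrimitive f v i a = 0 := by
  cases i with
  | zero => simpa [beamPrimitive] using h 0 le_rfl
  | succ i =>
    rw [beamPrimitive, setIntegral_congr_fun (g := fun _ => (0 : ℝ)) measurableSet_Ioi
      fun r hr => by simp [h r (le_of_lt hr)]]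
    simp

/-- From a point of the closure of a bounded open convex set that is not an outflow point, the ray
in direction `v` runs inside the set until it leaves it at an outflow point. -/
theorem exists_outflow_of_mem_closure {A : Set E} (hAo : IsOpen A) (hAb : Bornology.IsBounded A)
    (hAc : Convex ℝ A) {v : E} (hv : ‖v‖ = 1) {a : E} (ha : a ∈ closure A) :
    (a ∈ frontier A ∧ ∀ t : ℝ, 0 < t → a + t • v ∉ A) ∨
      ∃ T : ℝ, 0 < T ∧ a + T • v ∈ frontier A ∧ (∀ t : ℝ, 0 < t → a + T • v + t • v ∉ A) ∧
        ∀ t ∈ Ioo 0 T, a + t • v ∈ A := by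
  have hcont : Continuous fun t : ℝ => a + t • v := by fun_prop
  have hopen : ∀ t : ℝ, a + t • v ∈ A → ∃ s, t < s ∧ a + s • v ∈ A := fun t ht => by
    have h1 := (hAo.preimage hcont).mem_nhds ht
    obtain ⟨s, hs, hs'⟩ := ((mem_nhdsWithin_of_mem_nhds h1 : _ ∈ nhdsWithin t (Ioi t)) |>
      Filter.inter_mem self_mem_nhdsWithin |> Filter.nonempty_of_mem)
    exact ⟨s, hs, hs'⟩
  by_cases hout : ∀ t : ℝ, 0 < t → a + t • v ∉ A
  · refine Or.inl ⟨⟨ha, fun hai => ?_⟩, hout⟩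
    obtain ⟨s, hs, hsA⟩ := hopen 0 (by simpa using interior_subset hai)
    exact hout s hs hsA
  right
  push Not at hout
  set S : Set ℝ := {t | 0 < t ∧ a + t • v ∈ A} with hS
  have hne : S.Nonempty := hout
  obtain ⟨R, hR⟩ := hAb.exists_norm_le
  have hbdd : BddAbove S := ⟨R + ‖a‖, fun t ht => by
    have h1 : ‖t • v‖ ≤ ‖a + t • v‖ + ‖a‖ := by
      simpa using norm_sub_le (a + t • v) a
    rw [norm_smul, hv, mul_one, Real.norm_of_nonneg ht.1.le] at h1
    linarith [hR _ ht.2]⟩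
  have hpos : 0 < sSup S := by
    obtain ⟨s, hs⟩ := hne
    exact hs.1.trans_le (le_csSup hbdd hs)
  have hnot : ∀ s, sSup S < s → a + s • v ∉ A := fun s hs hsA =>
    absurd (le_csSup hbdd (show s ∈ S from ⟨hpos.trans hs, hsA⟩)) (not_le.2 hs)
  refine ⟨sSup S, hpos, ⟨?_, fun hi => ?_⟩, fun t ht => ?_, fun t ht => ?_⟩
  · exact map_mem_closure (f := fun t : ℝ => a + t • v) hcont (csSup_mem_closure hne hbdd) fun t ht => ht.2
  · obtain ⟨s, hs, hsA⟩ := hopen _ (interior_subset hi)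
    exact hnot s hs hsA
  · rw [add_assoc, ← add_smul]
    exact hnot _ (by linarith)
  · obtain ⟨s, hs, hts⟩ := exists_lt_of_lt_csSup hne ht.2
    have hsA : a + s • v ∈ interior A := hAo.interior_eq.symm ▸ hs.2
    refine interior_subset (hAc.openSegment_closure_interior_subset_interior ha hsA ?_)
    rw [openSegment_eq_image']
    refine ⟨t / s, ⟨div_pos ht.1 hs.1, (div_lt_one hs.1).2 hts⟩, ?_⟩
    simp only [add_sub_cancel_left, smul_smul, div_mul_cancel₀ _ hs.1.ne']

theorem eq_zero_on_closure_of_hasDerivAt_line {A : Set E} (hAo : IsOpen A)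
    (hAb : Bornology.IsBounded A) (hAc : Convex ℝ A) {v : E} (hv : ‖v‖ = 1) {d : E → ℝ}
    (hd : ∀ a, Continuous fun t : ℝ => d (a + t • v))
    (hd' : ∀ (a : E) (t : ℝ), a + t • v ∈ A → HasDerivAt (fun t : ℝ => d (a + t • v)) 0 t)
    (hout : ∀ b ∈ frontier A, (∀ t : ℝ, 0 < t → b + t • v ∉ A) → d b = 0)
    {a : E} (ha : a ∈ closure A) : d a = 0 := by
  rcases exists_outflow_of_mem_closure hAo hAb hAc hv ha with h | ⟨T, hT, hTf, hTo, hTA⟩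
  · exact hout a h.1 h.2
  obtain ⟨c, -, hc⟩ := exists_hasDerivAt_eq_slope (fun t : ℝ => d (a + t • v)) (fun _ => 0) hT
    (hd a).continuousOn fun t ht => hd' a t (hTA t ht)
  simpa [hout _ hTf hTo, hT.ne'] using hc.symm

/-- Near an outflow point `b`, all rays in direction `v` miss a compact subset of `A`. -/
theorem eventually_forall_ray_notMem {A K : Set E} (hAo : IsOpen A) (hK : IsCompact K)
    (hKA : K ⊆ A) {v b : E} (hb : b ∈ frontier A)
    (hout : ∀ t : ℝ, 0 < t → b + t • v ∉ A) :
    ∀ᶠ a in nhds b, ∀ r : ℝ, 0 ≤ r → a + r • v ∉ K := by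
  obtain ⟨δ, hδ, hδA⟩ := hK.exists_thickening_subset_open hAo hKA
  filter_upwards [Metric.ball_mem_nhds b hδ] with a ha r hr hrK
  have hbr : b + r • v ∈ A := hδA <| Metric.mem_thickening_iff.2
    ⟨a + r • v, hrK, by rwa [dist_add_right, dist_comm]⟩
  rcases hr.eq_or_lt with rfl | hr
  · rw [hAo.frontier_eq] at hb
    exact hb.2 (by simpa using hbr)
  · exact hout r hr hbr

end BeamPrimitive

theorem contDiff_dirDeriv_iterate {n : ℕ} {v : EuclideanSpace ℝ (Fin n)}
    {u : EuclideanSpace ℝ (Fin n) → ℝ} {m : ℕ} (j : ℕ) (hu : ContDiff ℝ (m + j : ℕ) u) :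
    ContDiff ℝ m ((dirDeriv n v)^[j] u) := by
  induction j generalizing m with
  | zero => simpa using hu
  | succ j ih =>
    rw [Function.iterate_succ_apply']
    have h := ih (m := m + 1) (by convert hu using 2; omega)
    exact (h.fderiv_right (m := (m : ℕ)) (by push_cast; exact le_rfl)).clm_apply contDiff_const

theorem hasDerivAt_line_dirDeriv {n : ℕ} (v : EuclideanSpace ℝ (Fin n))
    {g : EuclideanSpace ℝ (Fin n) → ℝ} (hg : Differentiable ℝ g)
    (a : EuclideanSpace ℝ (Fin n)) (t : ℝ) :
    HasDerivAt (fun t : ℝ => g (a + t • v)) (dirDeriv n v g (a + t • v)) t := by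
  have h : HasDerivAt (fun t : ℝ => a + t • v) v t := by
    simpa using ((hasDerivAt_id t).smul_const v).const_add a
  exact (hg (a + t • v)).hasFDerivAt.comp_hasDerivAt t h

/-- Range characterization of the `k`-weighted divergent beam transform on a
bounded open convex set `A` containing `supp f`: for `u ∈ C^{k+1}`, `u = R^k f(·,v)` on the
closure of `A` iff `(D_v)^{k+1} u = (-1)^{k+1} k! f` on `A` and the outflow boundary
conditions `(D_v)^j u = 0`, `j = 0,…,k`, hold. -/
theorem statement5 (n k : ℕ) (hn : 2 ≤ n)
    (A : Set (EuclideanSpace ℝ (Fin n)))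
    (hAo : IsOpen A) (hAb : Bornology.IsBounded A) (hAc : Convex ℝ A)
    (f : EuclideanSpace ℝ (Fin n) → ℝ)
    (hf : ContDiff ℝ (⊤ : ℕ∞) f) (hfc : HasCompactSupport f)
    (hfA : tsupport f ⊆ A)
    (v : EuclideanSpace ℝ (Fin n)) (hv : ‖v‖ = 1)
    (u : EuclideanSpace ℝ (Fin n) → ℝ) (hu : ContDiff ℝ (k + 1 : ℕ) u) :
    (∀ a ∈ closure A, u a = divergentBeam n k f a v) ↔
      ((∀ a ∈ A, (dirDeriv n v)^[k + 1] u a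
          = (-1) ^ (k + 1) * (Nat.factorial k : ℝ) * f a) ∧
        (∀ b ∈ frontier A, (∀ t : ℝ, 0 < t → b + t • v ∉ A) →
          ∀ j ≤ k, (dirDeriv n v)^[j] u b = 0)) := by
  have hf1 : ContDiff ℝ 1 f := hf.of_le (by exact_mod_cast le_top)
  have hdiff : ∀ j ≤ k, Differentiable ℝ ((dirDeriv n v)^[j] u) := fun j hj =>
    (contDiff_dirDeriv_iterate (m := k + 1 - j) j
      (by rwa [Nat.sub_add_cancel (by omega)])).differentiable
      (by simp only [ne_eq, Nat.cast_eq_zero]; omega)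
  have hdu : ∀ j ≤ k, ∀ a t, HasDerivAt (fun t : ℝ => (dirDeriv n v)^[j] u (a + t • v))
      ((dirDeriv n v)^[j + 1] u (a + t • v)) t := fun j hj a t => by
    rw [Function.iterate_succ_apply']
    exact hasDerivAt_line_dirDeriv v (hdiff j hj) a t
  have hbeam : ∀ a, divergentBeam n k f a v
      = (Nat.factorial k : ℝ) * beamPrimitive f v (k + 1) a := fun a => by
    have : (Nat.factorial k : ℝ) ≠ 0 := Nat.cast_ne_zero.2 k.factorial_ne_zero
    rw [divergentBeam, beamPrimitive]
    field_simp
  have hzero : ∀ b ∈ frontier A, (∀ t : ℝ, 0 < t → b + t • v ∉ A) →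
      ∀ᶠ a in nhds b, ∀ i, beamPrimitive f v i a = 0 := fun b hb hout => by
    filter_upwards [eventually_forall_ray_notMem hAo hfc hfA hb hout] with a ha
    exact beamPrimitive_eq_zero fun r hr => image_eq_zero_of_notMem_tsupport (ha r hr)
  constructor
  · intro h
    have hA : ∀ j i, i + j = k + 1 → ∀ a ∈ A, (dirDeriv n v)^[j] u a
        = (-1) ^ j * (Nat.factorial k : ℝ) * beamPrimitive f v i a := by
      intro j
      induction j with
      | zero =>
        rintro i rfl a ha
        rw [Function.iterate_zero, id, h a (subset_closure ha), hbeam]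
        simp
      | succ j ih =>
        intro i hi a ha
        have h1 := hdu j (by omega) a 0
        have h2 := (hasDerivAt_beamPrimitive hf1 hfc hv i a 0).const_mul
          ((-1) ^ j * (Nat.factorial k : ℝ))
        have hev : ∀ᶠ t : ℝ in nhds 0, a + t • v ∈ A :=
          (Continuous.continuousAt (by fun_prop : Continuous fun t : ℝ => a + t • v)).eventually_mem
            (hAo.mem_nhds (by simpa using ha))
        have h3 := h1.unique (h2.congr_of_eventuallyEq
          (hev.mono fun t ht => ih (i + 1) (by omega) _ ht))
        simp only [zero_smul, add_zero] at h3
        rw [h3]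
        ring
    refine ⟨fun a ha => hA (k + 1) 0 (by omega) a ha, fun b hb hout j hj => ?_⟩
    have hclosed : b ∈ closure {a | (dirDeriv n v)^[j] u a = 0} := by
      refine closure_mono ?_ ((mem_closure_iff_nhds.2 fun s hs => ?_ :
        b ∈ closure (A ∩ {a | ∀ i, beamPrimitive f v i a = 0})))
      · rintro a ⟨haA, ha0⟩
        rw [mem_ofPred_eq, hA j (k + 1 - j) (by omega) a haA, ha0, mul_zero]
      · obtain ⟨a, ⟨has, ha0⟩, haA⟩ := mem_closure_iff_nhds.1 hb.1 _
          (Filter.inter_mem hs (hzero b hb hout))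
        exact ⟨a, has, haA, ha0⟩
    rwa [(isClosed_eq (hdiff j hj).continuous continuous_const).closure_eq] at hclosed
  · rintro ⟨hA, hbd⟩
    have step : ∀ i j, i + j = k → (∀ a ∈ A, (dirDeriv n v)^[j + 1] u a
        = (-1) ^ (j + 1) * (Nat.factorial k : ℝ) * beamPrimitive f v i a) →
        ∀ a ∈ closure A, (dirDeriv n v)^[j] u a
          = (-1) ^ j * (Nat.factorial k : ℝ) * beamPrimitive f v (i + 1) a := by
      intro i j hij ih a ha
      have hd : ∀ a t, HasDerivAt (fun t : ℝ => (dirDeriv n v)^[j] u (a + t • v)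
          - (-1) ^ j * (Nat.factorial k : ℝ) * beamPrimitive f v (i + 1) (a + t • v))
          ((dirDeriv n v)^[j + 1] u (a + t • v)
            - (-1) ^ j * (Nat.factorial k : ℝ) * -beamPrimitive f v i (a + t • v)) t :=
        fun a t => (hdu j (by omega) a t).sub
          ((hasDerivAt_beamPrimitive hf1 hfc hv i a t).const_mul _)
      refine sub_eq_zero.1 (eq_zero_on_closure_of_hasDerivAt_line hAo hAb hAc hv
        (d := fun a => (dirDeriv n v)^[j] u a
          - (-1) ^ j * (Nat.factorial k : ℝ) * beamPrimitive f v (i + 1) a)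
        (fun a => continuous_iff_continuousAt.2 fun t => (hd a t).continuousAt)
        (fun a t hat => ?_) (fun b hb hout => ?_) ha)
      · convert hd a t using 1
        rw [ih _ hat]
        ring
      · simp only [hbd b hb hout j (by omega), (hzero b hb hout).self_of_nhds, mul_zero, sub_zero]
    have hcl : ∀ i j, i + j = k → ∀ a ∈ closure A, (dirDeriv n v)^[j] u a
        = (-1) ^ j * (Nat.factorial k : ℝ) * beamPrimitive f v (i + 1) a := by
      intro i
      induction i with
      | zero =>
        rintro j hj
        obtain rfl : j = k := by omega
        exact step 0 j hj hA
      | succ i ih =>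
        exact fun j hj => step (i + 1) j hj fun a ha => ih (j + 1) (by omega) a (subset_closure ha)
    intro a ha
    rw [hbeam, ← one_mul (Nat.factorial k : ℝ), ← pow_zero (-1 : ℝ)]
    exact hcl k 0 rfl a ha
end

section
/- Let n ≥ 2, k ∈ ℕ₀, and let 0 < m₀ < M₀ < ∞ and R > 0. Let h : ℝ × ℝ^{n-1} → ℝ be smooth with supp h ⊂ {(t, p̄) : t ∈ [−M₀, −m₀] and |p̄| ≤ −R t}. Define f : ℝ^n → ℝ by f(x̄, x_n) := x_n^{−k−2} h(−1/x_n, x̄/x_n) for x_n > 0 and f(x̄, x_n) := 0 for x_n ≤ 0. Then f is smooth on ℝ^n, compactly supported, and supp f ⊂ {(x̄, x_n) : 1/M₀ ≤ x_n ≤ 1/m₀ and |x̄| ≤ R}; in particular supp f ⊂ ℝ^{n-1}×(0,∞). -/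
open MeasureTheory Set

/-- A function whose value at `(x, s)` vanishes for `s ≤ 0` and is a multiple of `h (-1/s, x/s)` for
`0 < s` has topological support in a cylinder, if `h` has support in a truncated cone. -/
theorem tsupport_subset_cylinder_of_tsupport_subset_cone
    {E : Type*} [NormedAddCommGroup E] [NormedSpace ℝ E] {m M R : ℝ} (hm : 0 < m)
    {h : ℝ × E → ℝ}
    (hsupp : tsupport h ⊆ {q : ℝ × E | q.1 ∈ Icc (-M) (-m) ∧ ‖q.2‖ ≤ -R * q.1})
    {w : ℝ → ℝ} {f : E × ℝ → ℝ}
    (hf : ∀ x s, f (x, s) = if 0 < s then w s * h (-s⁻¹, s⁻¹ • x) else 0) :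
    tsupport f ⊆ {x : E × ℝ | x.2 ∈ Icc (1 / M) (1 / m) ∧ ‖x.1‖ ≤ R} := by
  refine closure_minimal ?_ ((isClosed_Icc.preimage continuous_snd).inter
    (isClosed_le continuous_fst.norm continuous_const))
  rintro ⟨x, s⟩ hx
  rw [Function.mem_support, hf] at hx
  split_ifs at hx with hs
  · obtain ⟨⟨h₁, h₂⟩, h₃⟩ := hsupp (subset_tsupport h (right_ne_zero_of_mul hx))
    simp only at h₁ h₂ h₃
    refine ⟨⟨?_, ?_⟩, ?_⟩
    · rw [one_div]
      exact inv_le_of_inv_le₀ hs (neg_le_neg_iff.mp h₁)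
    · rw [one_div]
      exact le_inv_of_le_inv₀ hm (neg_le_neg_iff.mp h₂)
    · rw [norm_smul, Real.norm_of_nonneg (inv_pos.mpr hs).le, neg_mul_neg, mul_comm R] at h₃
      exact le_of_mul_le_mul_left h₃ (inv_pos.mpr hs)
  · exact absurd rfl hx

/-- If `h` is smooth with `supp h ⊆ {(t,p̄) : t ∈ [-M₀,-m₀], |p̄| ≤ -R t}`,
then `f(x̄,xₙ) = xₙ^{-k-2} h(-1/xₙ, x̄/xₙ)` (for `xₙ > 0`, and `0` for `xₙ ≤ 0`) is smooth on
`ℝ^n`, compactly supported, and `supp f ⊆ {(x̄,xₙ) : 1/M₀ ≤ xₙ ≤ 1/m₀, |x̄| ≤ R}`; in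
particular `supp f ⊆ ℝ^{n-1}×(0,∞)`. -/
theorem statement14 (n k : ℕ) (hn : 2 ≤ n) (m₀ M₀ R : ℝ)
    (hm₀ : 0 < m₀) (hmM : m₀ < M₀) (hR : 0 < R)
    (h : ℝ × EuclideanSpace ℝ (Fin (n - 1)) → ℝ)
    (hh : ContDiff ℝ (⊤ : ℕ∞) h)
    (hsupp : tsupport h ⊆ {q : ℝ × EuclideanSpace ℝ (Fin (n - 1)) |
      q.1 ∈ Icc (-M₀) (-m₀) ∧ ‖q.2‖ ≤ -R * q.1})
    (f : EuclideanSpace ℝ (Fin (n - 1)) × ℝ → ℝ)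
    (hdef : ∀ (xb : EuclideanSpace ℝ (Fin (n - 1))) (xn : ℝ),
      f (xb, xn) = if 0 < xn then xn ^ (-(k : ℝ) - 2) * h (-xn⁻¹, xn⁻¹ • xb) else 0) :
    ContDiff ℝ (⊤ : ℕ∞) f ∧ HasCompactSupport f ∧
      tsupport f ⊆
        {x : EuclideanSpace ℝ (Fin (n - 1)) × ℝ |
          x.2 ∈ Icc (1 / M₀) (1 / m₀) ∧ ‖x.1‖ ≤ R} ∧
      tsupport f ⊆ {x : EuclideanSpace ℝ (Fin (n - 1)) × ℝ | 0 < x.2} := by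
  have hK := tsupport_subset_cylinder_of_tsupport_subset_cone hm₀ hsupp hdef
  have hpos : tsupport f ⊆ {x : EuclideanSpace ℝ (Fin (n - 1)) × ℝ | 0 < x.2} := fun x hx =>
    (one_div_pos.mpr (hm₀.trans hmM)).trans_le (hK hx).1.1
  refine ⟨contDiff_iff_contDiffAt.mpr fun x => ?_, ?_, hK, hpos⟩
  · by_cases hx : x ∉ tsupport f
    · exact contDiffAt_const.congr_of_eventuallyEq (notMem_tsupport_iff_eventuallyEq.mp hx)
    have hx₀ : 0 < x.2 := hpos (not_not.mp hx)
    have hsnd : ContDiffAt ℝ (⊤ : ℕ∞)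
        (fun y : EuclideanSpace ℝ (Fin (n - 1)) × ℝ => y.2) x := contDiffAt_snd
    have hinv := hsnd.inv hx₀.ne'
    refine ((hsnd.rpow_const_of_ne (p := -(k : ℝ) - 2) hx₀.ne').mul
      (hh.contDiffAt.comp x (hinv.neg.prodMk (hinv.smul contDiffAt_fst)))).congr_of_eventuallyEq ?_
    filter_upwards [(isOpen_lt continuous_const continuous_snd).mem_nhds hx₀] with y hy
    exact (hdef y.1 y.2).trans (if_pos hy)
  · refine ((isCompact_closedBall (0 : EuclideanSpace ℝ (Fin (n - 1))) R).prod
      (isCompact_Icc (a := 1 / M₀) (b := 1 / m₀))).of_isClosed_subset (isClosed_tsupport f) ?_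
    exact fun x hx => ⟨mem_closedBall_zero_iff.mpr (hK hx).2, (hK hx).1⟩
end
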